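/- Let A = Λ[J_1,…,J_n] be the exterior (free supercommutative) algebra on odd generators J_1,…,J_n, and ω = (ω_i^j) an n×n skew-symmetric scalar matrix. Write ω(J)_k = Σ_l ω_k^l J_l and ½JᵗωJ = Σ_{i<j} ω_{ij} J_i J_j. Then for any scalars c_1,…,c_n, (Σ_{k=1}^n c_k ω(J)_k) · exp(½ Jᵗ ω J) = Σ_{k=1}^n Σ_{I ⊆ {1,…,n}, k ∉ I, |I| odd} c_k · ε({k}, I) · Pf(ω_{I ∪ {k}}) · J^I, where for a subset S with |S| even, ω_S denotes the submatrix of ω indexed by S and Pf is its Pfaffian. -/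

import Mathlib

open scoped BigOperators

/-- The odd generator `J i` of the exterior algebra `Λ[J₁,…,Jₙ]` over ℂ. -/
noncomputable def Jgen (n : ℕ) (i : Fin n) : ExteriorAlgebra ℂ (Fin n → ℂ) :=
  ExteriorAlgebra.ι ℂ (Pi.single i 1)

/-- The ordered monomial `J^I = J_{i₁}⋯J_{i_p}` for `I = {i₁ < … < i_p}`. -/
noncomputable def Jmon (n : ℕ) (S : Finset (Fin n)) : ExteriorAlgebra ℂ (Fin n → ℂ) :=
  ((S.sort (· ≤ ·)).map (Jgen n)).prod


namespace Stmt6Aux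

open CliffordAlgebra

variable {n : ℕ}

lemma J_sq (i : Fin n) : Jgen n i * Jgen n i = 0 := by
  simp [Jgen]

lemma J_swap (i j : Fin n) : Jgen n i * Jgen n j = - (Jgen n j * Jgen n i) := by
  have := ExteriorAlgebra.ι_add_mul_swap (R := ℂ) (M := Fin n → ℂ) (Pi.single i 1) (Pi.single j 1)
  exact eq_neg_of_add_eq_zero_left this

lemma perm_prod {l l' : List (Fin n)} (h : l.Perm l') :
    ∃ s : ℂ, s * s = 1 ∧ (l.map (Jgen n)).prod = s • (l'.map (Jgen n)).prod := by
  induction h with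
  | nil => exact ⟨1, by simp, by simp⟩
  | cons a _ ih =>
    obtain ⟨s, hs, h⟩ := ih
    exact ⟨s, hs, by simp [h]⟩
  | swap a b l =>
    refine ⟨-1, by simp, ?_⟩
    simp only [List.map_cons, List.prod_cons, ← mul_assoc]
    rw [J_swap b a]; simp
  | trans _ _ h1 h2 =>
    obtain ⟨s, hs, h⟩ := h1
    obtain ⟨t, ht, h'⟩ := h2
    refine ⟨s * t, by linear_combination hs * (t*t) + ht, ?_⟩
    rw [h, h', smul_smul]

lemma J_mul_mon (k : Fin n) (I : Finset (Fin n)) (hk : k ∉ I) :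
    ∃ s : ℂ, s * s = 1 ∧ Jgen n k * Jmon n I = s • Jmon n (insert k I) := by
  have hp : (k :: I.sort (· ≤ ·)).Perm ((insert k I).sort (· ≤ ·)) := by
    rw [← Multiset.coe_eq_coe, ← Multiset.cons_coe]
    simp [Finset.sort_eq, Finset.insert_val_of_notMem hk]
  obtain ⟨s, hs, h⟩ := perm_prod hp
  exact ⟨s, hs, by simpa [Jmon] using h⟩

lemma J_mul_mon_mem (k : Fin n) (I : Finset (Fin n)) (hk : k ∈ I) :
    Jgen n k * Jmon n I = 0 := by
  obtain ⟨s, hs, h⟩ := J_mul_mon k (I.erase k) (by simp)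
  rw [Finset.insert_erase hk] at h
  have : Jmon n I = s • (Jgen n k * Jmon n (I.erase k)) := by
    rw [h, smul_smul, hs, one_smul]
  rw [this, mul_smul_comm, ← mul_assoc, J_sq]; simp

/-- The span of monomials of a fixed degree. -/
def sp (n m : ℕ) : Submodule ℂ (ExteriorAlgebra ℂ (Fin n → ℂ)) :=
  Submodule.span ℂ {x | ∃ S : Finset (Fin n), S.card = m ∧ x = Jmon n S}

lemma J_mul_sp (k : Fin n) {m : ℕ} {x} (hx : x ∈ sp n m) : Jgen n k * x ∈ sp n (m+1) := by
  induction hx using Submodule.span_induction with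
  | mem x h =>
    obtain ⟨S, hS, rfl⟩ := h
    by_cases hk : k ∈ S
    · rw [J_mul_mon_mem k S hk]; exact Submodule.zero_mem _
    · obtain ⟨s, _, h⟩ := J_mul_mon k S hk
      rw [h]
      exact Submodule.smul_mem _ _ (Submodule.subset_span ⟨_, by simp [hk, hS], rfl⟩)
  | zero => simp
  | add x y _ _ hx hy => rw [mul_add]; exact Submodule.add_mem _ hx hy
  | smul a x _ hx => rw [mul_smul_comm]; exact Submodule.smul_mem _ _ hx

/-- The quadratic element restricted to `S`. -/
noncomputable def Om (ω : Matrix (Fin n) (Fin n) ℂ) (S : Finset (Fin n)) :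
    ExteriorAlgebra ℂ (Fin n → ℂ) :=
  ∑ i ∈ S, ∑ j ∈ S, if i < j then ω i j • (Jgen n i * Jgen n j) else 0

lemma Om_pow_mem (ω : Matrix (Fin n) (Fin n) ℂ) (m : ℕ) :
    Om ω Finset.univ ^ m ∈ sp n (2 * m) := by
  induction m with
  | zero => exact Submodule.subset_span ⟨∅, by simp, by simp [Jmon]⟩
  | succ m ih =>
    rw [pow_succ', Om, Finset.sum_mul]
    refine Submodule.sum_mem _ fun i _ => ?_
    rw [Finset.sum_mul]
    refine Submodule.sum_mem _ fun j _ => ?_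
    split_ifs
    · rw [smul_mul_assoc, mul_assoc]
      exact Submodule.smul_mem _ _ (J_mul_sp i (J_mul_sp j ih))
    · simp

lemma sp_expand {m : ℕ} {x} (hx : x ∈ sp n m) : ∃ a : Finset (Fin n) → ℂ,
    x = ∑ S, if S.card = m then a S • Jmon n S else 0 := by
  induction hx using Submodule.span_induction with
  | mem x h =>
    obtain ⟨S, hS, rfl⟩ := h
    refine ⟨fun T => if T = S then 1 else 0, ?_⟩
    rw [Finset.sum_eq_single S]
    · simp [hS]
    · intro T _ hT; simp [hT]
    · simp
  | zero => exact ⟨0, by simp⟩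
  | add x y _ _ hx hy =>
    obtain ⟨a, rfl⟩ := hx
    obtain ⟨b, rfl⟩ := hy
    refine ⟨a + b, ?_⟩
    rw [← Finset.sum_add_distrib]
    refine Finset.sum_congr rfl fun S _ => ?_
    split_ifs <;> simp [add_smul]
  | smul r x _ hx =>
    obtain ⟨a, rfl⟩ := hx
    refine ⟨r • a, ?_⟩
    rw [Finset.smul_sum]
    refine Finset.sum_congr rfl fun S _ => ?_
    split_ifs <;> simp [mul_smul]

/-- Projection killing the generators outside `S`. -/
noncomputable def proj (S : Finset (Fin n)) :
    ExteriorAlgebra ℂ (Fin n → ℂ) →ₐ[ℂ] ExteriorAlgebra ℂ (Fin n → ℂ) :=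
  ExteriorAlgebra.map (LinearMap.pi fun i => if i ∈ S then LinearMap.proj i else 0)

lemma proj_J (S : Finset (Fin n)) (i : Fin n) :
    proj S (Jgen n i) = if i ∈ S then Jgen n i else 0 := by
  have : (LinearMap.pi fun j => if j ∈ S then LinearMap.proj j else 0 :
      (Fin n → ℂ) →ₗ[ℂ] (Fin n → ℂ)) (Pi.single i 1) = if i ∈ S then Pi.single i 1 else 0 := by
    ext j
    by_cases hij : j = i
    · subst hij; by_cases hj : j ∈ S <;> simp [hj]
    · by_cases hj : j ∈ S <;> by_cases hi : i ∈ S <;> simp [hj, hi, hij]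
  rw [proj, Jgen, ExteriorAlgebra.map_apply_ι, this]
  split_ifs <;> simp

lemma proj_mon_self (S : Finset (Fin n)) : proj S (Jmon n S) = Jmon n S := by
  rw [Jmon, map_list_prod, List.map_map]
  congr 1
  refine List.map_congr_left fun i hi => ?_
  simp at hi
  simp [proj_J, hi]

lemma proj_mon_ne (S T : Finset (Fin n)) (h : ¬ T ⊆ S) : proj S (Jmon n T) = 0 := by
  obtain ⟨i, hi, hiS⟩ := Finset.not_subset.1 h
  rw [Jmon, map_list_prod, List.map_map]
  apply List.prod_eq_zero
  rw [List.mem_map]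
  exact ⟨i, by simpa using hi, by simp [proj_J, hiS]⟩

lemma proj_Om (ω : Matrix (Fin n) (Fin n) ℂ) (S : Finset (Fin n)) :
    proj S (Om ω Finset.univ) = Om ω S := by
  have e : ∀ f : Fin n → ExteriorAlgebra ℂ (Fin n → ℂ),
      ∑ i ∈ S, f i = ∑ i, if i ∈ S then f i else 0 := fun f => by simp
  simp only [Om, map_sum, e]
  refine Finset.sum_congr rfl fun i _ => ?_
  by_cases hi : i ∈ S
  · simp only [hi, if_true]
    refine Finset.sum_congr rfl fun j _ => ?_
    by_cases hj : j ∈ S <;> split_ifs <;> simp [proj_J, hi, hj]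
  · simp only [hi, if_false]
    refine Finset.sum_eq_zero fun j _ => ?_
    split_ifs <;> simp [proj_J, hi]

lemma Om_pow (ω : Matrix (Fin n) (Fin n) ℂ) (Pf : Finset (Fin n) → ℂ)
    (hPf : ∀ (S : Finset (Fin n)) (m : ℕ), S.card = 2 * m →
      Om ω S ^ m = (m.factorial : ℂ) • Pf S • Jmon n S) (m : ℕ) :
    Om ω Finset.univ ^ m =
      (m.factorial : ℂ) • ∑ S, if S.card = 2 * m then Pf S • Jmon n S else 0 := by
  obtain ⟨a, ha⟩ := sp_expand (Om_pow_mem ω m)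
  rw [ha, Finset.smul_sum]
  refine Finset.sum_congr rfl fun S _ => ?_
  split_ifs with hS
  · rw [← hPf S m hS, ← proj_Om, ← map_pow, ha, map_sum, Finset.sum_eq_single S]
    · simp [hS, proj_mon_self]
    · intro T _ hT
      split_ifs with hc
      · rw [map_smul, proj_mon_ne, smul_zero]
        intro hTS
        exact hT (Finset.eq_of_subset_of_card_le hTS (by omega))
      · simp
    · simp
  · simp

/-- Left contraction with the `k`-th coordinate. -/
noncomputable def del (k : Fin n) :
    ExteriorAlgebra ℂ (Fin n → ℂ) →ₗ[ℂ] ExteriorAlgebra ℂ (Fin n → ℂ) :=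
  contractLeft (Q := (0 : QuadraticForm ℂ (Fin n → ℂ))) (LinearMap.proj k)

lemma del_one (k : Fin n) : del k 1 = 0 :=
  contractLeft_one (0 : QuadraticForm ℂ (Fin n → ℂ)) _

lemma del_J_mul (k i : Fin n) (x : ExteriorAlgebra ℂ (Fin n → ℂ)) :
    del k (Jgen n i * x) = (if i = k then x else 0) - Jgen n i * del k x := by
  have := contractLeft_ι_mul (Q := (0 : QuadraticForm ℂ (Fin n → ℂ)))
    (LinearMap.proj k) (Pi.single i 1) x
  refine Eq.trans this ?_
  by_cases h : i = k
  · subst h; simp; rfl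
  · simp [h, Pi.single_apply, Ne.symm h]; rfl

lemma del_mon_notMem (k : Fin n) (S : Finset (Fin n)) (hk : k ∉ S) : del k (Jmon n S) = 0 := by
  have : ∀ l : List (Fin n), k ∉ l → del k (l.map (Jgen n)).prod = 0 := by
    intro l
    induction l with
    | nil => intro _; simp [del_one]
    | cons a l ih =>
      intro h
      simp only [List.mem_cons, not_or] at h
      simp [del_J_mul, ih h.2, Ne.symm h.1]
  exact this _ (by simpa using hk)

lemma del_mon_insert (k : Fin n) (I : Finset (Fin n)) (hk : k ∉ I) (e : ℂ)
    (he : Jgen n k * Jmon n I = e • Jmon n (insert k I)) :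
    del k (Jmon n (insert k I)) = e • Jmon n I := by
  obtain ⟨s, hs, h⟩ := J_mul_mon k I hk
  have h0 : del k (Jgen n k * Jmon n I) = Jmon n I := by
    simp [del_J_mul, del_mon_notMem k I hk]
  have h1 : del k (Jmon n (insert k I)) = s • Jmon n I := by
    rw [← h0, h, map_smul, smul_smul, hs, one_smul]
  have h2 : Jmon n I = e • s • Jmon n I := by
    rw [← h1, ← map_smul, ← he, h0]
  calc del k (Jmon n (insert k I)) = s • Jmon n I := h1
    _ = s • e • s • Jmon n I := by rw [← h2]
    _ = (s * s) • e • Jmon n I := by simp only [smul_smul]; congr 1; ring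
    _ = e • Jmon n I := by rw [hs, one_smul]

lemma J_comm_Om (ω : Matrix (Fin n) (Fin n) ℂ) (k : Fin n) (S : Finset (Fin n)) :
    Commute (Jgen n k) (Om ω S) := by
  refine Commute.sum_right _ _ _ fun i _ => Commute.sum_right _ _ _ fun j _ => ?_
  split_ifs
  · refine Commute.smul_right ?_ _
    change _ * (_ * _) = _ * _ * _
    rw [← mul_assoc, J_swap k i, neg_mul, mul_assoc, J_swap k j, mul_neg, neg_neg, mul_assoc]
  · exact Commute.zero_right _

/-- The linear element `ω(J)_k`. -/
noncomputable def th (ω : Matrix (Fin n) (Fin n) ℂ) (k : Fin n) :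
    ExteriorAlgebra ℂ (Fin n → ℂ) := ∑ l, ω k l • Jgen n l

lemma del_Om_mul (ω : Matrix (Fin n) (Fin n) ℂ) (hskew : Matrix.transpose ω = -ω) (k : Fin n)
    (x : ExteriorAlgebra ℂ (Fin n → ℂ)) :
    del k (Om ω Finset.univ * x) = th ω k * x + Om ω Finset.univ * del k x := by
  have hs : ∀ i j, ω j i = - ω i j := fun i j => by
    have := congrFun (congrFun hskew i) j
    simpa using this
  have key : ∀ i j, del k ((if i < j then ω i j • (Jgen n i * Jgen n j) else 0) * x)
      = ((if i = k then (if i < j then ω i j • (Jgen n j * x) else 0) else 0)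
        - (if j = k then (if i < j then ω i j • (Jgen n i * x) else 0) else 0))
        + (if i < j then ω i j • (Jgen n i * Jgen n j) else 0) * del k x := by
    intro i j
    by_cases hij : i < j
    · simp only [hij, if_true, smul_mul_assoc, map_smul, mul_assoc, del_J_mul]
      by_cases hi : i = k <;> by_cases hj : j = k <;> simp [hi, hj, mul_sub, smul_sub, smul_add]
      all_goals abel
    · simp [hij]
  simp only [Om, Finset.sum_mul, map_sum, key, Finset.sum_add_distrib]
  congr 1
  simp only [Finset.sum_sub_distrib]
  rw [Finset.sum_eq_single k (by intro b _ hb; simp [hb]) (by simp)]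
  simp only [if_true, Finset.sum_ite_eq', Finset.mem_univ]
  rw [← Finset.sum_sub_distrib, th, Finset.sum_mul]
  refine Finset.sum_congr rfl fun l _ => ?_
  rcases lt_trichotomy k l with h | h | h
  · simp [h, h.not_gt]
  · subst h
    have : ω k k = 0 := self_eq_neg.1 (hs k k)
    simp [this]
  · simp [h, h.not_gt, hs l k]

lemma del_Om_pow (ω : Matrix (Fin n) (Fin n) ℂ) (hskew : Matrix.transpose ω = -ω) (k : Fin n)
    (p : ℕ) : del k (Om ω Finset.univ ^ (p+1)) = ((p : ℂ) + 1) • (th ω k * Om ω Finset.univ ^ p) := by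
  have hc : Commute (th ω k) (Om ω Finset.univ) :=
    Commute.sum_left _ _ _ fun l _ => Commute.smul_left (J_comm_Om ω l _) _
  induction p with
  | zero => have := del_Om_mul ω hskew k 1; simpa [del_one] using this
  | succ p ih =>
    rw [pow_succ', del_Om_mul ω hskew, ih, mul_smul_comm, ← mul_assoc, ← hc.eq, mul_assoc,
      ← pow_succ']
    push_cast
    rw [add_smul ((p:ℂ)+1), one_smul, add_comm]

end Stmt6Aux

open Stmt6Aux

/-- In the exterior algebra on odd generators `J₁,…,Jₙ`, with `ω` skew-symmetric,
`(Σₖ cₖ ω(J)ₖ) · exp(½ JᵗωJ) = Σₖ Σ_{I ∌ k} cₖ ε({k},I) Pf(ω_{I∪{k}}) J^I`, where `Pf` is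
characterized by `(Σ_{i<j∈S} ωᵢⱼ JᵢJⱼ)^m = m! · Pf(ω_S) J^S` for `|S| = 2m` (and vanishes on
odd-sized sets), `ε({k},I)` by `J_k J^I = ε({k},I) J^{I∪{k}}`, and the exponential of the
nilpotent even element `½ JᵗωJ` is the finite sum `Σ_{p≤n} (1/p!)(½JᵗωJ)^p`. -/
theorem stmt6 (n : ℕ) (ω : Matrix (Fin n) (Fin n) ℂ) (hskew : Matrix.transpose ω = -ω)
    (Pf : Finset (Fin n) → ℂ)
    (hPf : ∀ (S : Finset (Fin n)) (m : ℕ), S.card = 2 * m →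
      (∑ i ∈ S, ∑ j ∈ S, if i < j then ω i j • (Jgen n i * Jgen n j) else 0) ^ m
        = (m.factorial : ℂ) • Pf S • Jmon n S)
    (hPfodd : ∀ S : Finset (Fin n), ¬ Even S.card → Pf S = 0)
    (ε : Fin n → Finset (Fin n) → ℂ)
    (hε : ∀ (k : Fin n) (I : Finset (Fin n)), k ∉ I →
      Jgen n k * Jmon n I = ε k I • Jmon n (insert k I))
    (hε0 : ∀ (k : Fin n) (I : Finset (Fin n)), k ∈ I → ε k I = 0)
    (c : Fin n → ℂ) :
    (∑ k, c k • ∑ l, ω k l • Jgen n l) *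
        (∑ p ∈ Finset.range (n + 1), (p.factorial : ℂ)⁻¹ •
          (∑ i, ∑ j, if i < j then ω i j • (Jgen n i * Jgen n j) else 0) ^ p)
      = ∑ k, ∑ I : Finset (Fin n),
          if k ∉ I then (c k * ε k I * Pf (insert k I)) • Jmon n I else 0 := by
  change ∀ (S : Finset (Fin n)) (m : ℕ), S.card = 2 * m →
      Om ω S ^ m = (m.factorial : ℂ) • Pf S • Jmon n S at hPf
  change (∑ k, c k • th ω k) * (∑ p ∈ Finset.range (n + 1), (p.factorial : ℂ)⁻¹ •
    Om ω Finset.univ ^ p) = _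
  have hexp : (∑ p ∈ Finset.range (n + 1), (p.factorial : ℂ)⁻¹ • Om ω Finset.univ ^ p)
      = ∑ S, Pf S • Jmon n S := by
    have : ∀ p, (p.factorial : ℂ)⁻¹ • Om ω Finset.univ ^ p
        = ∑ S, if S.card = 2 * p then Pf S • Jmon n S else 0 := fun p => by
      rw [Om_pow ω Pf hPf, smul_smul, inv_mul_cancel₀ (by exact_mod_cast p.factorial_ne_zero),
        one_smul]
    simp only [this]
    rw [Finset.sum_comm]
    refine Finset.sum_congr rfl fun S _ => ?_
    by_cases hS : Even S.card
    · obtain ⟨m, hm⟩ := hS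
      have hle : S.card ≤ n := by simpa using S.card_le_univ
      rw [Finset.sum_eq_single m]
      · rw [if_pos (by omega)]
      · intro b _ hb; rw [if_neg (by omega)]
      · intro h; simp at h; omega
    · rw [hPfodd S hS]; simp
  have hdel : ∀ k, th ω k * (∑ p ∈ Finset.range (n + 1), (p.factorial : ℂ)⁻¹ •
      Om ω Finset.univ ^ p) = del k (∑ p ∈ Finset.range (n + 1), (p.factorial : ℂ)⁻¹ •
      Om ω Finset.univ ^ p) := by
    intro k
    have hn : 0 < n := k.pos
    have htop : Om ω Finset.univ ^ n = 0 := by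
      rw [Om_pow ω Pf hPf, Finset.sum_eq_zero, smul_zero]
      intro S _
      have hle : S.card ≤ n := by simpa using S.card_le_univ
      rw [if_neg (by omega)]
    rw [map_sum, Finset.sum_range_succ, htop, smul_zero, add_zero, Finset.sum_range_succ',
      Finset.mul_sum]
    simp only [map_smul, pow_zero, del_one, smul_zero, add_zero]
    refine Finset.sum_congr rfl fun p _ => ?_
    rw [del_Om_pow ω hskew, smul_smul, mul_smul_comm, Nat.factorial_succ]
    congr 1
    have h1 : (p.factorial : ℂ) ≠ 0 := by exact_mod_cast p.factorial_ne_zero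
    have h2 : (p : ℂ) + 1 ≠ 0 := by exact_mod_cast p.succ_ne_zero
    push_cast
    field_simp
  rw [Finset.sum_mul]
  refine Finset.sum_congr rfl fun k _ => ?_
  rw [smul_mul_assoc, hdel, hexp, map_sum, Finset.smul_sum, ← Finset.sum_filter,
    ← Finset.sum_filter_add_sum_filter_not Finset.univ (fun S : Finset (Fin n) => k ∈ S)]
  rw [Finset.sum_eq_zero (s := Finset.univ.filter fun S : Finset (Fin n) => ¬ k ∈ S), add_zero]
  · symm
    refine Finset.sum_bij' (fun I _ => insert k I) (fun S _ => S.erase k) ?_ ?_ ?_ ?_ ?_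
    · intro I _; simp
    · intro S _; simp
    · intro I hI; exact Finset.erase_insert (by simpa using hI)
    · intro S hS; exact Finset.insert_erase (by simpa using hS)
    · intro I hI
      have hI' : k ∉ I := by simpa using hI
      rw [map_smul, del_mon_insert k I hI' _ (hε k I hI'), smul_smul, smul_smul]
      congr 1; ring
  · intro S hS
    rw [map_smul, del_mon_notMem k S (by simpa using hS)]; simp
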